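/- arXiv:math/0703746 — 2 statements merged into one kernel-verified Lean document; each statement's English description precedes it below -/
import Mathlib

section
/- Let K ≥ 3 be a natural number, y : Fin K → ℝ with S > 0, and let p be a real number with 0 ≤ p < (K−2)/2. Then the function (μ, λ) ↦ λ^p · f(μ, λ) is integrable over ℝ × (0, ∞) and the p-th posterior moment of λ equals E(λ^p | y) = (S/2)^p · Γ((K−2)/2 − p) / Γ((K−2)/2), where Γ is the Gamma function. -/
open MeasureTheory Real Set

lemma integrableOn_rpow_mul_exp_neg_div_Ioi {a r : ℝ} (ha : 0 < a) (hr : 0 < r) :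
    IntegrableOn (fun l : ℝ => l ^ (-a - 1) * exp (-(r / l))) (Ioi 0) := by
  have h : IntegrableOn (fun x : ℝ => x ^ (a - 1) * exp (-r * x ^ (1 : ℝ))) (Ioi 0) :=
    integrableOn_rpow_mul_exp_neg_mul_rpow (by linarith) one_pos hr
  rw [← integrableOn_Ioi_comp_rpow_iff' _ (show (-1 : ℝ) ≠ 0 by norm_num)] at h
  refine h.congr_fun (fun l hl => ?_) measurableSet_Ioi
  have hl : 0 < l := hl
  simp only [smul_eq_mul, rpow_one, rpow_neg_one, div_eq_mul_inv, neg_mul]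
  rw [inv_rpow hl.le, ← rpow_neg hl.le, ← mul_assoc, ← rpow_add hl]
  congr 2
  ring

lemma integral_rpow_mul_exp_neg_div_Ioi {a r : ℝ} (ha : 0 < a) (hr : 0 < r) :
    ∫ l in Ioi (0 : ℝ), l ^ (-a - 1) * exp (-(r / l)) = (1 / r) ^ a * Gamma a := by
  rw [← integral_rpow_mul_exp_neg_mul_Ioi ha hr,
    ← integral_comp_rpow_Ioi _ (show (-1 : ℝ) ≠ 0 by norm_num)]
  refine setIntegral_congr_fun measurableSet_Ioi (fun l hl => ?_)
  have hl : 0 < l := hl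
  simp only [smul_eq_mul, rpow_neg_one, div_eq_mul_inv, abs_neg, abs_one, one_mul, inv_inv]
  rw [inv_rpow hl.le, ← rpow_neg hl.le, ← mul_assoc, ← rpow_add hl]
  congr 2
  ring

lemma sum_sub_sq_eq_add_sq_mean {K : ℕ} (hK : 0 < K) (y : Fin K → ℝ) (m : ℝ)
    (hm : m = (1 / (K : ℝ)) * ∑ j, y j) (μ : ℝ) :
    ∑ j, (y j - μ) ^ 2 = ∑ j, (y j - m) ^ 2 + K * (μ - m) ^ 2 := by
  have hK' : (K : ℝ) ≠ 0 := by positivity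
  have hsum : ∑ j, y j = K * m := by rw [hm]; field_simp
  have h : ∀ j, (y j - μ) ^ 2 = (y j - m) ^ 2 + (2 * (m - μ) * y j + (μ ^ 2 - m ^ 2)) :=
    fun j => by ring
  simp only [h, Finset.sum_add_distrib, ← Finset.mul_sum, hsum, Finset.sum_const,
    Finset.card_univ, Fintype.card_fin, nsmul_eq_mul]
  ring

section NormalKernel

variable {k m S l : ℝ}

lemma integrable_rpow_mul_exp_normal (b : ℝ) (hk : 0 < k) (hl : 0 < l) :
    Integrable (fun μ : ℝ => l ^ b * exp (-(1 / (2 * l)) * (S + k * (μ - m) ^ 2))) := by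
  have h := (((integrable_exp_neg_mul_sq (show 0 < k / (2 * l) by positivity)).comp_sub_right
    m).const_mul (exp (-(1 / (2 * l)) * S))).const_mul (l ^ b)
  refine h.congr (.of_forall fun μ => ?_)
  simp only [← exp_add]
  congr 2
  field_simp
  ring

lemma integral_rpow_mul_exp_normal (b : ℝ) (hk : 0 < k) (hl : 0 < l) :
    ∫ μ : ℝ, l ^ b * exp (-(1 / (2 * l)) * (S + k * (μ - m) ^ 2)) =
      √(2 * π / k) * (l ^ (b + 1 / 2) * exp (-(S / 2 / l))) := by
  have h (μ : ℝ) : l ^ b * exp (-(1 / (2 * l)) * (S + k * (μ - m) ^ 2)) =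
      (l ^ b * exp (-(S / 2 / l))) * exp (-(k / (2 * l)) * (μ - m) ^ 2) := by
    rw [mul_assoc, ← exp_add]
    congr 2
    field_simp
    ring
  simp only [h]
  rw [integral_const_mul,
    integral_sub_right_eq_self (fun x => exp (-(k / (2 * l)) * x ^ 2)) m, integral_gaussian,
    show π / (k / (2 * l)) = 2 * π / k * l by field_simp, sqrt_mul (by positivity), sqrt_eq_rpow l,
    rpow_add hl]
  ring

lemma integrableOn_rpow_mul_exp_normal_prod {b : ℝ} (hb : b < -(3 / 2)) (hk : 0 < k)
    (hS : 0 < S) :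
    IntegrableOn (fun q : ℝ × ℝ => q.2 ^ b *
      exp (-(1 / (2 * q.2)) * (S + k * (q.1 - m) ^ 2))) (univ ×ˢ Ioi 0) := by
  rw [IntegrableOn, Measure.volume_eq_prod, ← Measure.prod_restrict, Measure.restrict_univ,
    integrable_prod_iff' (by fun_prop)]
  have hmem := ae_restrict_mem (μ := (volume : Measure ℝ)) (measurableSet_Ioi (a := (0 : ℝ)))
  constructor
  · filter_upwards [hmem] with l hl
    exact integrable_rpow_mul_exp_normal b hk hl
  · have h := (integrableOn_rpow_mul_exp_neg_div_Ioi (a := -b - 3 / 2) (by linarith)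
      (half_pos hS)).const_mul (√(2 * π / k))
    refine Integrable.congr h ?_
    filter_upwards [hmem] with l hl
    have hl : 0 < l := hl
    have hn (μ : ℝ) : ‖l ^ b * exp (-(1 / (2 * l)) * (S + k * (μ - m) ^ 2))‖ =
        l ^ b * exp (-(1 / (2 * l)) * (S + k * (μ - m) ^ 2)) :=
      norm_of_nonneg (by positivity)
    simp only [hn]
    rw [integral_rpow_mul_exp_normal b hk hl]
    congr 3
    ring

lemma integral_integral_rpow_mul_exp_normal {b : ℝ} (hb : b < -(3 / 2)) (hk : 0 < k)
    (hS : 0 < S) :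
    ∫ l in Ioi (0 : ℝ), ∫ μ : ℝ, l ^ b * exp (-(1 / (2 * l)) * (S + k * (μ - m) ^ 2)) =
      √(2 * π / k) * ((1 / (S / 2)) ^ (-b - 3 / 2) * Gamma (-b - 3 / 2)) := by
  rw [← integral_rpow_mul_exp_neg_div_Ioi (by linarith) (half_pos hS), ← integral_const_mul]
  refine setIntegral_congr_fun measurableSet_Ioi (fun l hl => ?_)
  rw [integral_rpow_mul_exp_normal b hk hl]
  congr 3
  ring

end NormalKernel

/-- For `K ≥ 3`, `S > 0` and `0 ≤ p < (K-2)/2`, the function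
`(μ, λ) ↦ λ^p · f(μ, λ)` is integrable over `ℝ × (0, ∞)` and the `p`-th posterior
moment of `λ` equals `(S/2)^p · Γ((K-2)/2 - p) / Γ((K-2)/2)`. -/
theorem posterior_moment_lambda
    (K : ℕ) (hK : 3 ≤ K) (y : Fin K → ℝ)
    (ybar : ℝ) (hybar : ybar = (1 / (K : ℝ)) * ∑ j, y j)
    (S : ℝ) (hS : S = ∑ j, (y j - ybar) ^ 2) (hSpos : 0 < S)
    (f : ℝ → ℝ → ℝ)
    (hf : ∀ (μ l : ℝ),
      f μ l = l ^ (-(((K : ℝ) + 1) / 2)) *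
        Real.exp (-(1 / (2 * l)) * ∑ j, (y j - μ) ^ 2))
    (p : ℝ) (hp0 : 0 ≤ p) (hp : p < ((K : ℝ) - 2) / 2) :
    IntegrableOn (fun q : ℝ × ℝ => q.2 ^ p * f q.1 q.2)
      ((Set.univ : Set ℝ) ×ˢ Set.Ioi (0 : ℝ)) ∧
    (∫ l in Set.Ioi (0 : ℝ), ∫ μ : ℝ, l ^ p * f μ l) /
      (∫ l in Set.Ioi (0 : ℝ), ∫ μ : ℝ, f μ l) =
        (S / 2) ^ p * Real.Gamma (((K : ℝ) - 2) / 2 - p) /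
          Real.Gamma (((K : ℝ) - 2) / 2) := by
  have hk : (0 : ℝ) < K := by positivity
  have hf' (b μ l : ℝ) (hl : 0 < l) : l ^ b * f μ l =
      l ^ (b - ((K : ℝ) + 1) / 2) * exp (-(1 / (2 * l)) * (S + K * (μ - ybar) ^ 2)) := by
    rw [hf, sum_sub_sq_eq_add_sq_mean (by omega) y ybar hybar, ← hS, ← mul_assoc,
      ← rpow_add hl, ← sub_eq_add_neg]
  have hint (b : ℝ) (hb : b < ((K : ℝ) - 2) / 2) :
      ∫ l in Ioi (0 : ℝ), ∫ μ : ℝ, l ^ b * f μ l = √(2 * π / K) *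
        ((1 / (S / 2)) ^ (((K : ℝ) - 2) / 2 - b) * Gamma (((K : ℝ) - 2) / 2 - b)) := by
    rw [show ((K : ℝ) - 2) / 2 - b = -(b - ((K : ℝ) + 1) / 2) - 3 / 2 by ring,
      ← integral_integral_rpow_mul_exp_normal (m := ybar) (by linarith) hk hSpos]
    exact setIntegral_congr_fun measurableSet_Ioi fun l hl =>
      integral_congr_ae (.of_forall fun μ => hf' b μ l hl)
  constructor
  · refine (integrableOn_rpow_mul_exp_normal_prod (m := ybar) (b := p - ((K : ℝ) + 1) / 2)
      (by linarith) hk hSpos).congr_fun (fun q hq => (hf' p q.1 q.2 hq.2).symm)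
      (MeasurableSet.univ.prod measurableSet_Ioi)
  · have h0 := hint 0 (hp0.trans_lt hp)
    simp only [rpow_zero, one_mul, sub_zero] at h0
    have hG : Gamma (((K : ℝ) - 2) / 2) ≠ 0 := (Gamma_pos_of_pos (hp0.trans_lt hp)).ne'
    have hπ : √(2 * π / K) ≠ 0 := by positivity
    have hr : (1 / (S / 2)) ^ (((K : ℝ) - 2) / 2) ≠ 0 := by positivity
    rw [hint p hp, h0, rpow_sub (by positivity), one_div (S / 2), inv_rpow (by positivity) p]
    rw [one_div] at hr
    field_simp
end

section
/- Let K ≥ 11 be a natural number and y : Fin K → ℝ with S > 0. Then there exists δ > 0 such that both (μ, λ) ↦ λ^{4+δ} · f(μ, λ) and (μ, λ) ↦ |μ|^{4+δ} · f(μ, λ) are integrable over ℝ × (0, ∞); that is, when K > 10 the posterior has finite moments of order strictly greater than 4 for both coordinates (the moment conditions E_π|g|^{2+ε₁+ε₂} < ∞ with ε₁ > 2 required for consistent batch means with batch-size exponent θ = 1/2, for g(μ,λ) = μ and g(μ,λ) = λ). -/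
open MeasureTheory Real Set

lemma rpow_mul_exp_neg_le {r t : ℝ} (hr : 0 < r) (ht : 0 ≤ t) :
    t ^ r * exp (-t) ≤ r ^ r := by
  have h : (t / r) ^ r ≤ exp t := by
    calc (t / r) ^ r ≤ (exp (t / r)) ^ r :=
          rpow_le_rpow (by positivity) (by linarith [add_one_le_exp (t / r)]) hr.le
      _ = exp t := by rw [← exp_mul, div_mul_cancel₀ _ hr.ne']
  rw [div_rpow ht hr.le, div_le_iff₀ (by positivity)] at h
  calc t ^ r * exp (-t) ≤ exp t * r ^ r * exp (-t) := by gcongr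
    _ = r ^ r := by rw [mul_right_comm, ← exp_add]; simp

lemma integrableOn_rpow_neg_mul_exp_neg_div {b w : ℝ} (hb : 0 < b) (hw : 1 < w) :
    IntegrableOn (fun x : ℝ => x ^ (-w) * exp (-b / x)) (Ioi 0) := by
  have h := integrableOn_rpow_mul_exp_neg_mul_rpow (p := 1) (s := w - 2) (b := b)
    (by linarith) one_pos hb
  rw [← integrableOn_Ioi_comp_rpow_iff' _ (p := -1) (by norm_num)] at h
  refine h.congr_fun (fun x hx => ?_) measurableSet_Ioi
  have hx : 0 < x := hx
  simp only [smul_eq_mul, rpow_one]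
  rw [← rpow_mul hx.le, ← mul_assoc, ← rpow_add hx, rpow_neg_one, ← div_eq_mul_inv]
  ring_nf

lemma integrableOn_one_add_sq_rpow_mul_rpow_neg_mul_exp {c q r s : ℝ} (hc : 0 < c) (hq : 0 ≤ q)
    (hr : 1 / 2 < r) (hs : r + q + 1 < s) :
    IntegrableOn (fun p : ℝ × ℝ =>
        (1 + p.1 ^ 2) ^ q * (p.2 ^ (-s) * exp (-(c * (1 + p.1 ^ 2)) / p.2)))
      (univ ×ˢ Ioi 0) := by
  have hμ : IntegrableOn (fun μ : ℝ => (1 + μ ^ 2) ^ (-r)) univ := by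
    have h := integrable_rpow_neg_one_add_norm_sq (E := ℝ) (μ := volume) (r := 2 * r)
      (by simp; linarith)
    rw [integrableOn_univ]
    refine h.congr (.of_forall fun μ => ?_)
    simp only [norm_eq_abs, sq_abs]
    ring_nf
  have hl := integrableOn_rpow_neg_mul_exp_neg_div (b := c / 2) (w := s - (r + q))
    (by positivity) (by linarith)
  have hprod := (Integrable.mul_prod hμ hl).const_mul ((2 * (r + q) / c) ^ (r + q))
  rw [Measure.prod_restrict] at hprod
  refine Integrable.mono' hprod (by measurability) ?_
  refine (ae_restrict_mem (MeasurableSet.univ.prod measurableSet_Ioi)).mono ?_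
  rintro ⟨μ, x⟩ ⟨-, hx⟩
  have hx : 0 < x := hx
  have hR : 0 < r + q := by linarith
  simp only
  have hA : 1 ≤ 1 + μ ^ 2 := by nlinarith [sq_nonneg μ]
  generalize 1 + μ ^ 2 = A at hA ⊢
  have hA0 : 0 < A := by linarith
  rw [norm_of_nonneg (by positivity)]
  have hb := rpow_mul_exp_neg_le hR (t := c * A / (2 * x)) (by positivity)
  have hb' : exp (-(c * A / (2 * x))) ≤
      (2 * (r + q) / c) ^ (r + q) * (x ^ (r + q) * A ^ (-(r + q))) := by
    rw [← le_div_iff₀' (by positivity), ← div_rpow hR.le (by positivity)] at hb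
    refine hb.trans_eq ?_
    rw [rpow_neg hA0.le, ← inv_rpow hA0.le, ← mul_rpow (by positivity) (by positivity),
      ← mul_rpow (by positivity) (by positivity)]
    congr 1
    field_simp
  have he : exp (-(c * A) / x) = exp (-(c * A / (2 * x))) * exp (-(c * A / (2 * x))) := by
    rw [← exp_add]; congr 1; field_simp; ring
  have hS : exp (-(c * A / (2 * x))) ≤ exp (-(c / 2) / x) := by
    rw [exp_le_exp, neg_div, neg_le_neg_iff, div_div]
    gcongr
    nlinarith
  calc A ^ q * (x ^ (-s) * exp (-(c * A) / x))
      ≤ A ^ q * (x ^ (-s) * (((2 * (r + q) / c) ^ (r + q) * (x ^ (r + q) * A ^ (-(r + q)))) *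
          exp (-(c / 2) / x))) := by
        rw [he]; gcongr
    _ = (2 * (r + q) / c) ^ (r + q) * ((A ^ q * A ^ (-(r + q))) *
          ((x ^ (-s) * x ^ (r + q)) * exp (-(c / 2) / x))) := by ring
    _ = _ := by
        rw [← rpow_add hA0, ← rpow_add hx]
        ring_nf

lemma exists_mul_one_add_sq_le_sum_sq {K : ℕ} (hK : 1 ≤ K) (y : Fin K → ℝ) {ybar : ℝ}
    (hybar : ybar = (1 / (K : ℝ)) * ∑ j, y j) (hS : 0 < ∑ j, (y j - ybar) ^ 2) :
    ∃ c : ℝ, 0 < c ∧ ∀ μ : ℝ, c * (1 + μ ^ 2) ≤ ∑ j, (y j - μ) ^ 2 := by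
  have hK' : (1 : ℝ) ≤ K := by exact_mod_cast hK
  have hsum : ∑ j, y j = K * ybar := by rw [hybar]; field_simp
  have hdecomp (μ : ℝ) :
      ∑ j, (y j - μ) ^ 2 = ∑ j, (y j - ybar) ^ 2 + K * (μ - ybar) ^ 2 := by
    have (ν : ℝ) : ∑ j, (y j - ν) ^ 2 = ∑ j, y j ^ 2 - 2 * (K * ybar) * ν + K * ν ^ 2 := by
      simp only [sub_sq, Finset.sum_add_distrib, Finset.sum_sub_distrib, ← Finset.sum_mul,
        ← Finset.mul_sum, hsum]
      simp
    rw [this, this]; ring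
  generalize ∑ j, (y j - ybar) ^ 2 = S at hS hdecomp
  refine ⟨(2 + (1 + 2 * ybar ^ 2) / S)⁻¹, by positivity, fun μ => ?_⟩
  rw [inv_mul_le_iff₀ (by positivity), hdecomp]
  have h1 : (1 + 2 * ybar ^ 2) / S * S = 1 + 2 * ybar ^ 2 := by field_simp
  have h2 : 0 ≤ (1 + 2 * ybar ^ 2) / S := by positivity
  have h3 : 0 ≤ (1 + 2 * ybar ^ 2) / S * (K * (μ - ybar) ^ 2) := by positivity
  have h4 : (μ - ybar) ^ 2 ≤ K * (μ - ybar) ^ 2 := le_mul_of_one_le_left (sq_nonneg _) hK'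
  nlinarith [sq_nonneg (μ - 2 * ybar)]

/-- For `K ≥ 11` and `S > 0`, there exists `δ > 0` such that both
`(μ, λ) ↦ λ^{4+δ} · f(μ, λ)` and `(μ, λ) ↦ |μ|^{4+δ} · f(μ, λ)` are integrable
over `ℝ × (0, ∞)`: when `K > 10` the posterior has finite moments of order
strictly greater than 4 for both coordinates (the moment conditions needed for
consistent batch means with θ = 1/2 for g(μ,λ) = μ and g(μ,λ) = λ). -/
theorem posterior_moments_gt_four_of_eleven_le
    (K : ℕ) (hK : 11 ≤ K) (y : Fin K → ℝ)
    (ybar : ℝ) (hybar : ybar = (1 / (K : ℝ)) * ∑ j, y j)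
    (S : ℝ) (hS : S = ∑ j, (y j - ybar) ^ 2) (hSpos : 0 < S)
    (f : ℝ → ℝ → ℝ)
    (hf : ∀ (μ l : ℝ),
      f μ l = l ^ (-(((K : ℝ) + 1) / 2)) *
        Real.exp (-(1 / (2 * l)) * ∑ j, (y j - μ) ^ 2)) :
    ∃ δ : ℝ, 0 < δ ∧
      IntegrableOn (fun p : ℝ × ℝ => p.2 ^ (4 + δ) * f p.1 p.2)
        ((Set.univ : Set ℝ) ×ˢ Set.Ioi (0 : ℝ)) ∧
      IntegrableOn (fun p : ℝ × ℝ => |p.1| ^ (4 + δ) * f p.1 p.2)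
        ((Set.univ : Set ℝ) ×ˢ Set.Ioi (0 : ℝ)) := by
  obtain ⟨c, hc, hle⟩ := exists_mul_one_add_sq_le_sum_sq (by omega) y hybar (hS ▸ hSpos)
  have hK' : (11 : ℝ) ≤ K := by exact_mod_cast hK
  have hf' : (fun p : ℝ × ℝ => f p.1 p.2) = fun p : ℝ × ℝ =>
      p.2 ^ (-(((K : ℝ) + 1) / 2)) * exp (-(1 / (2 * p.2)) * ∑ j, (y j - p.1) ^ 2) :=
    funext fun p => hf p.1 p.2
  have hmeas : Measurable fun p : ℝ × ℝ => f p.1 p.2 := by rw [hf']; fun_prop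
  have hexponent (μ x : ℝ) (hx : 0 < x) :
      -(1 / (2 * x)) * ∑ j, (y j - μ) ^ 2 ≤ -(c / 2 * (1 + μ ^ 2)) / x := by
    calc -(1 / (2 * x)) * ∑ j, (y j - μ) ^ 2
        ≤ -(1 / (2 * x)) * (c * (1 + μ ^ 2)) := by
          rw [neg_mul, neg_mul, neg_le_neg_iff]
          gcongr
          exact hle μ
      _ = -(c / 2 * (1 + μ ^ 2)) / x := by field_simp
  refine ⟨1 / 4, by norm_num, ?_, ?_⟩
  · refine Integrable.mono' (integrableOn_one_add_sq_rpow_mul_rpow_neg_mul_exp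
      (c := c / 2) (q := 0) (r := 3 / 5) (s := ((K : ℝ) + 1) / 2 - (4 + 1 / 4))
      (by positivity) le_rfl (by norm_num) (by linarith))
      (Measurable.aestronglyMeasurable (by fun_prop)) ?_
    refine (ae_restrict_mem (MeasurableSet.univ.prod measurableSet_Ioi)).mono ?_
    rintro ⟨μ, x⟩ ⟨-, hx⟩
    have hx : 0 < x := hx
    simp only [hf, rpow_zero, one_mul]
    rw [norm_of_nonneg (by positivity), ← mul_assoc, ← rpow_add hx, neg_sub, ← sub_eq_add_neg]
    gcongr
    exact hexponent μ x hx
  · refine Integrable.mono' (integrableOn_one_add_sq_rpow_mul_rpow_neg_mul_exp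
      (c := c / 2) (q := (4 + 1 / 4) / 2) (r := 1) (s := ((K : ℝ) + 1) / 2)
      (by positivity) (by norm_num) (by norm_num) (by linarith))
      (Measurable.aestronglyMeasurable (by fun_prop)) ?_
    refine (ae_restrict_mem (MeasurableSet.univ.prod measurableSet_Ioi)).mono ?_
    rintro ⟨μ, x⟩ ⟨-, hx⟩
    have hx : 0 < x := hx
    simp only [hf]
    rw [norm_of_nonneg (by positivity)]
    gcongr
    · calc |μ| ^ (4 + 1 / 4 : ℝ) = (|μ| ^ (2 : ℝ)) ^ ((4 + 1 / 4) / 2 : ℝ) := by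
            rw [← rpow_mul (abs_nonneg μ)]; norm_num
        _ ≤ (1 + μ ^ 2) ^ ((4 + 1 / 4) / 2 : ℝ) := by
            rw [rpow_two, sq_abs]
            gcongr
            linarith
    · exact hexponent μ x hx
end
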